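/- For every integer n ≥ 1, the total number of humps summed over all double-Dyck paths of length 2(n+1) (Dyck paths of length 2(n+1) whose partial sum after the first 2·⌊(n+1)/2⌋ steps is 0) equals HC_{⌊(n+1)/2⌋}·C_{⌈(n+1)/2⌉} + C_{⌊(n+1)/2⌋}·HC_{⌈(n+1)/2⌉}, where C_m is the m-th Catalan number and HC_m is the total number of humps over all Dyck paths of length 2m. -/

import Mathlib

open Finset

/-- The value of a Dyck-path step: `true` is an up-step (+1), `false` a down-step (-1). -/
def stepVal (b : Bool) : ℤ := if b then 1 else -1

/-- Partial sum of the first `k` steps of a ±1 path of length `m`. -/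
def partialSum {m : ℕ} (p : Fin m → Bool) (k : ℕ) : ℤ :=
  ∑ i ∈ Finset.univ.filter (fun i : Fin m => (i : ℕ) < k), stepVal (p i)

/-- A Dyck path: total sum 0 and all partial sums nonnegative. -/
def IsDyckPath {m : ℕ} (p : Fin m → Bool) : Prop :=
  partialSum p m = 0 ∧ ∀ k ≤ m, 0 ≤ partialSum p k

open Classical in
/-- The finset of Dyck paths of length `m`. -/
noncomputable def dyckPaths (m : ℕ) : Finset (Fin m → Bool) :=
  Finset.univ.filter (fun p => IsDyckPath p)

/-- Number of humps (an up-step immediately followed by a down-step) of a path. -/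
def humps {m : ℕ} (p : Fin m → Bool) : ℕ :=
  (Finset.univ.filter (fun i : Fin (m - 1) =>
    p ⟨(i : ℕ), by have := i.isLt; omega⟩ = true ∧
    p ⟨(i : ℕ) + 1, by have := i.isLt; omega⟩ = false)).card

/-- `HC n`: the total number of humps over all Dyck paths of length `2n`. -/
noncomputable def HC (n : ℕ) : ℕ := ∑ p ∈ dyckPaths (2 * n), humps p

open Classical in
/-- Double-Dyck paths: Dyck paths of length `2(n+1)` passing through `(2⌊(n+1)/2⌋, 0)`. -/
noncomputable def doubleDyckPaths (n : ℕ) : Finset (Fin (2 * (n + 1)) → Bool) :=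
  (dyckPaths (2 * (n + 1))).filter (fun p => partialSum p (2 * ((n + 1) / 2)) = 0)

/-- A path extended to all of `ℕ` by up-steps. -/
def extendPath {m : ℕ} (p : Fin m → Bool) (i : ℕ) : Bool :=
  if h : i < m then p ⟨i, h⟩ else true

lemma extendPath_of_lt {m : ℕ} (p : Fin m → Bool) {i : ℕ} (h : i < m) :
    extendPath p i = p ⟨i, h⟩ := by
  simp [extendPath, h]

lemma extendPath_of_le {m : ℕ} (p : Fin m → Bool) {i : ℕ} (h : m ≤ i) :
    extendPath p i = true := by
  simp [extendPath, h]

lemma partialSum_eq_sum_range {m : ℕ} (p : Fin m → Bool) {k : ℕ} (hk : k ≤ m) :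
    partialSum p k = ∑ i ∈ range k, stepVal (extendPath p i) := by
  refine Finset.sum_bij (fun i _ => (i : ℕ)) ?_ ?_ ?_ ?_
  · intro i hi
    simpa using hi
  · intro i _ j _ h
    exact Fin.ext h
  · intro i hi
    have hi' := Finset.mem_range.1 hi
    exact ⟨⟨i, by omega⟩, by simpa using hi', rfl⟩
  · intro i _
    rw [extendPath_of_lt p i.isLt]

lemma humps_eq_card_range {m : ℕ} (p : Fin m → Bool) :
    humps p =
      #{i ∈ range m | extendPath p i = true ∧ extendPath p (i + 1) = false} := by
  refine Finset.card_bij (fun i _ => (i : ℕ)) ?_ ?_ ?_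
  · intro i hi
    have h := i.isLt
    rw [Finset.mem_filter] at hi ⊢
    rw [extendPath_of_lt p (by omega), extendPath_of_lt p (by omega), Finset.mem_range]
    exact ⟨by omega, hi.2⟩
  · intro i _ j _ h
    exact Fin.ext h
  · intro i hi
    obtain ⟨hi, hu, hd⟩ := Finset.mem_filter.1 hi
    have him : i + 1 < m := by
      by_contra! h
      simp [extendPath_of_le p h] at hd
    rw [extendPath_of_lt p (by omega)] at hu hd
    exact ⟨⟨i, by omega⟩, by simp [hu, hd], rfl⟩

lemma extendPath_append_left {m n : ℕ} (p : Fin m → Bool) (q : Fin n → Bool) {i : ℕ}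
    (hi : i < m) : extendPath (Fin.append p q) i = extendPath p i := by
  rw [extendPath_of_lt _ (by omega), extendPath_of_lt _ hi]
  exact Fin.append_left p q ⟨i, hi⟩

lemma extendPath_append_right {m n : ℕ} (p : Fin m → Bool) (q : Fin n → Bool) (i : ℕ) :
    extendPath (Fin.append p q) (m + i) = extendPath q i := by
  by_cases hi : i < n
  · rw [extendPath_of_lt _ (by omega), extendPath_of_lt _ hi]
    exact Fin.append_right p q ⟨i, hi⟩
  · rw [extendPath_of_le _ (by omega), extendPath_of_le _ (by omega)]

lemma partialSum_append_left {m n : ℕ} (p : Fin m → Bool) (q : Fin n → Bool) {k : ℕ}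
    (hk : k ≤ m) : partialSum (Fin.append p q) k = partialSum p k := by
  rw [partialSum_eq_sum_range _ (by omega), partialSum_eq_sum_range _ hk]
  refine Finset.sum_congr rfl fun i hi => ?_
  rw [extendPath_append_left p q (by have := Finset.mem_range.1 hi; omega)]

lemma partialSum_append_right {m n : ℕ} (p : Fin m → Bool) (q : Fin n → Bool) {k : ℕ}
    (hk : k ≤ n) :
    partialSum (Fin.append p q) (m + k) = partialSum p m + partialSum q k := by
  rw [partialSum_eq_sum_range _ (by omega), Finset.sum_range_add,
    ← partialSum_eq_sum_range _ (by omega), partialSum_append_left p q le_rfl,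
    partialSum_eq_sum_range _ hk]
  simp only [extendPath_append_right]

lemma isDyckPath_append_iff {m n : ℕ} (p : Fin m → Bool) (q : Fin n → Bool) :
    IsDyckPath (Fin.append p q) ∧ partialSum (Fin.append p q) m = 0 ↔
      IsDyckPath p ∧ IsDyckPath q := by
  simp only [IsDyckPath, partialSum_append_left p q le_rfl, partialSum_append_right p q le_rfl]
  constructor
  · rintro ⟨⟨h, hpos⟩, hp⟩
    refine ⟨⟨hp, fun k hk => ?_⟩, by omega, fun k hk => ?_⟩
    · simpa [partialSum_append_left p q hk] using hpos k (by omega)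
    · simpa [partialSum_append_right p q hk, hp] using hpos (m + k) (by omega)
  · rintro ⟨⟨hp, hp'⟩, hq, hq'⟩
    refine ⟨⟨by omega, fun k hk => ?_⟩, hp⟩
    rcases le_total k m with hkm | hkm
    · rw [partialSum_append_left p q hkm]
      exact hp' k hkm
    · obtain ⟨j, rfl⟩ := Nat.exists_eq_add_of_le hkm
      rw [partialSum_append_right p q (by omega), hp, zero_add]
      exact hq' j (by omega)

lemma IsDyckPath.extendPath_zero {m : ℕ} {p : Fin m → Bool} (hp : IsDyckPath p) :
    extendPath p 0 = true := by
  rcases Nat.eq_zero_or_pos m with rfl | hm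
  · exact extendPath_of_le p le_rfl
  · have h := hp.2 1 hm
    rw [partialSum_eq_sum_range p hm, Finset.sum_range_one] at h
    by_contra hne
    simp [stepVal, hne] at h

lemma humps_append {m n : ℕ} (p : Fin m → Bool) {q : Fin n → Bool} (hq : IsDyckPath q) :
    humps (Fin.append p q) = humps p + humps q := by
  simp only [humps_eq_card_range, Finset.card_filter, Finset.sum_range_add, add_assoc,
    extendPath_append_right]
  congr 1
  refine Finset.sum_congr rfl fun i hi => ?_
  have hi := Finset.mem_range.1 hi
  rw [extendPath_append_left p q hi]
  rcases Nat.lt_or_ge (i + 1) m with h | h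
  · rw [extendPath_append_left p q h]
  · obtain rfl : m = i + 1 := by omega
    have h0 := extendPath_append_right p q 0
    rw [hq.extendPath_zero, add_zero] at h0
    rw [h0, extendPath_of_le p le_rfl]

/-- The Dyck word letter of a step. -/
def toDyckStep (b : Bool) : DyckStep := if b then DyckStep.U else DyckStep.D

lemma toDyckStep_injective : Function.Injective toDyckStep := by
  intro a b
  cases a <;> cases b <;> simp [toDyckStep]

lemma partialSum_eq_count_sub_count {m : ℕ} (p : Fin m → Bool) {k : ℕ} (hk : k ≤ m) :
    partialSum p k =
      (((List.ofFn (toDyckStep ∘ p)).take k).count DyckStep.U : ℤ) -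
        ((List.ofFn (toDyckStep ∘ p)).take k).count DyckStep.D := by
  rw [partialSum_eq_sum_range p hk]
  induction k with
  | zero => simp
  | succ k ih =>
    rw [Finset.sum_range_succ, ih (by omega), extendPath_of_lt p hk,
      List.take_add_one, List.getElem?_eq_getElem (by simpa using hk)]
    cases h : p ⟨k, hk⟩ <;> simp [List.count_append, toDyckStep, h, stepVal] <;> ring

lemma isDyckPath_iff_count {m : ℕ} (p : Fin m → Bool) :
    IsDyckPath p ↔
      (List.ofFn (toDyckStep ∘ p)).count DyckStep.U =
          (List.ofFn (toDyckStep ∘ p)).count DyckStep.D ∧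
        ∀ k, ((List.ofFn (toDyckStep ∘ p)).take k).count DyckStep.D ≤
          ((List.ofFn (toDyckStep ∘ p)).take k).count DyckStep.U := by
  have htake : ∀ k, m ≤ k →
      (List.ofFn (toDyckStep ∘ p)).take k = List.ofFn (toDyckStep ∘ p) :=
    fun k hk => List.take_of_length_le (by simpa using hk)
  rw [IsDyckPath, partialSum_eq_count_sub_count p le_rfl, htake m le_rfl]
  constructor
  · rintro ⟨h, hpos⟩
    refine ⟨by omega, fun k => ?_⟩
    rcases le_total k m with hk | hk
    · have := hpos k hk
      rw [partialSum_eq_count_sub_count p hk] at this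
      omega
    · rw [htake k hk]
      omega
  · rintro ⟨h, hle⟩
    refine ⟨by omega, fun k hk => ?_⟩
    rw [partialSum_eq_count_sub_count p hk]
    have := hle k
    omega

lemma mem_dyckPaths {m : ℕ} {p : Fin m → Bool} : p ∈ dyckPaths m ↔ IsDyckPath p := by
  simp [dyckPaths]

lemma card_dyckPaths (m : ℕ) : #(dyckPaths (2 * m)) = catalan m := by
  rw [← DyckWord.card_dyckWord_semilength_eq_catalan, ← Finset.card_univ]
  have hmem {p : Fin (2 * m) → Bool} (hp : p ∈ dyckPaths (2 * m)) :=
    (isDyckPath_iff_count p).1 (mem_dyckPaths.1 hp)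
  refine Finset.card_bij
    (fun p hp => ⟨⟨List.ofFn (toDyckStep ∘ p), (hmem hp).1, (hmem hp).2⟩, ?_⟩) ?_ ?_ ?_
  · have h := DyckWord.two_mul_semilength_eq_length
      (p := ⟨List.ofFn (toDyckStep ∘ p), (hmem hp).1, (hmem hp).2⟩)
    simp only [List.length_ofFn] at h
    omega
  · intro p hp
    exact Finset.mem_univ _
  · intro p hp q hq h
    have h' := List.ofFn_injective (congrArg (fun w => w.1.toList) h)
    exact toDyckStep_injective.comp_left h'
  · rintro ⟨w, hw⟩ _
    have hlen : w.toList.length = 2 * m := by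
      rw [← w.two_mul_semilength_eq_length, hw]
    let p : Fin (2 * m) → Bool := fun i => decide (w.toList[i] = DyckStep.U)
    have hp : List.ofFn (toDyckStep ∘ p) = w.toList := by
      refine List.ext_getElem (by simp [hlen]) fun i h₁ h₂ => ?_
      rcases (w.toList[i]).dichotomy with h | h <;> simp [p, toDyckStep, h]
    refine ⟨p, ?_, ?_⟩
    · refine mem_dyckPaths.2 ((isDyckPath_iff_count p).2 ?_)
      rw [hp]
      exact ⟨w.count_U_eq_count_D, w.count_D_le_count_U⟩
    · exact Subtype.ext (DyckWord.ext hp)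

open Classical in
lemma sum_humps_dyckPaths_returning (N a b : ℕ) (hN : N = 2 * a + 2 * b) :
    ∑ p ∈ dyckPaths N with partialSum p (2 * a) = 0, humps p =
      HC a * catalan b + catalan a * HC b := by
  subst hN
  have hbij : ∑ p ∈ dyckPaths (2 * a + 2 * b) with partialSum p (2 * a) = 0, humps p =
      ∑ x ∈ dyckPaths (2 * a) ×ˢ dyckPaths (2 * b), (humps x.1 + humps x.2) := by
    symm
    refine Finset.sum_equiv (Fin.appendEquiv (2 * a) (2 * b)) ?_ ?_
    · rintro ⟨p, q⟩
      simpa [mem_dyckPaths, Fin.appendEquiv] using (isDyckPath_append_iff p q).symm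
    · rintro ⟨p, q⟩ h
      have hq : IsDyckPath q := mem_dyckPaths.1 (Finset.mem_product.1 h).2
      exact (humps_append p hq).symm
  rw [hbij, Finset.sum_product]
  simp only [Finset.sum_add_distrib, Finset.sum_const, card_dyckPaths, smul_eq_mul,
    ← Finset.mul_sum, HC]
  ring

/-- The total number of humps over all double-Dyck paths of length `2(n+1)` equals
`HC_{⌊(n+1)/2⌋} · C_{⌈(n+1)/2⌉} + C_{⌊(n+1)/2⌋} · HC_{⌈(n+1)/2⌉}`. -/
theorem double_dyck_humps (n : ℕ) (hn : 1 ≤ n) :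
    ∑ p ∈ doubleDyckPaths n, humps p =
      HC ((n + 1) / 2) * catalan ((n + 2) / 2) +
        catalan ((n + 1) / 2) * HC ((n + 2) / 2) :=
  sum_humps_dyckPaths_returning _ _ _ (by omega)
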